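/- Let n be a positive integer with n ≡ 2 (mod 9) or n ≡ 8 (mod 9). Then ∑_{k=0}^{n−1} (q;q^9)_k (q;q^9)_k (q^7;q^9)_k · q^{9k} / (q^9;q^9)_k^3 ≡ 0 (mod Φ_n(q)^2), as rational functions of q over ℚ. -/

import Mathlib

open Finset Polynomial

/-- The q-shifted factorial `(x; q)_k = ∏_{j=0}^{k-1} (1 - x q^j)` in `RatFunc ℚ`. -/
noncomputable def qPoch (x q : RatFunc ℚ) (k : ℕ) : RatFunc ℚ :=
  ∏ j ∈ Finset.range k, (1 - x * q ^ j)

/-- `A ≡ 0 (mod P)`: `A = P · B` for some rational function `B` whose denominator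
(in lowest terms) is coprime to `P`. -/
def CongrZero (A : RatFunc ℚ) (P : Polynomial ℚ) : Prop :=
  ∃ B : RatFunc ℚ, A = algebraMap (Polynomial ℚ) (RatFunc ℚ) P * B ∧ IsCoprime B.denom P

theorem qPoch_succ (x q : RatFunc ℚ) (k : ℕ) :
    qPoch x q (k + 1) = qPoch x q k * (1 - x * q ^ k) :=
  Finset.prod_range_succ _ _

theorem qPoch_succ' (x q : RatFunc ℚ) (k : ℕ) :
    qPoch x q (k + 1) = (1 - x) * qPoch (x * q) q k := by
  simp only [qPoch, Finset.prod_range_succ']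
  simp [pow_succ', mul_assoc, mul_comm]

theorem qPoch_mul_shift (x q : RatFunc ℚ) (k : ℕ) :
    (1 - x) * qPoch (x * q) q k = qPoch x q k * (1 - x * q ^ k) := by
  rw [← qPoch_succ', qPoch_succ]

/-- The telescoped form of the contiguous relation behind the `q`-Saalschütz sum. -/
theorem sum_contiguous (Q b x : RatFunc ℚ) (hQ : Q ≠ 0) (hb : b ≠ 0) (hx : x ≠ 0)
    (hbx : 1 - b * x ≠ 0) (hd : ∀ k, qPoch Q Q k ≠ 0) (m : ℕ) :
    ∑ k ∈ range (m + 1),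
      ((1 - x * Q) ^ 2 * b *
          (qPoch (x * Q)⁻¹ Q k * qPoch (b * (x * Q)) Q k * qPoch (Q / b) Q k * Q ^ k
            / qPoch Q Q k ^ 3) -
        (1 - b * x) ^ 2 * Q *
          (qPoch x⁻¹ Q k * qPoch (b * x) Q k * qPoch (Q / b) Q k * Q ^ k / qPoch Q Q k ^ 3)) =
      b * (1 - b * x ^ 2 * Q) / (1 - b * x) *
        (qPoch x⁻¹ Q m * qPoch (b * x) Q (m + 1) * qPoch (Q / b) Q (m + 1) / qPoch Q Q m ^ 3) := by
  induction m with
  | zero =>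
    have hbx' : 1 - x * b ≠ 0 := by rwa [mul_comm]
    simp [qPoch]
    field_simp
    ring
  | succ m ih =>
    rw [Finset.sum_range_succ, ih]
    have h1 : qPoch (x * Q)⁻¹ Q (m + 1) = (1 - (x * Q)⁻¹) * qPoch x⁻¹ Q m := by
      rw [qPoch_succ']
      congr 2
      field_simp
    have h2 : qPoch (b * (x * Q)) Q (m + 1) =
        qPoch (b * x) Q (m + 1) * (1 - b * x * Q ^ (m + 1)) / (1 - b * x) := by
      rw [eq_div_iff hbx, ← qPoch_mul_shift, mul_assoc b x Q]
      ring
    have h3 := hd (m + 1)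
    rw [qPoch_succ] at h3
    have h4 := left_ne_zero_of_mul h3
    have h5 := right_ne_zero_of_mul h3
    rw [h1, h2, qPoch_succ x⁻¹, qPoch_succ (b * x) Q (m + 1), qPoch_succ (Q / b) Q (m + 1),
      qPoch_succ Q Q m]
    generalize qPoch x⁻¹ Q m = P
    generalize qPoch (b * x) Q (m + 1) = B
    generalize qPoch (Q / b) Q (m + 1) = E
    generalize qPoch Q Q m = D at *
    rw [pow_succ Q m]
    generalize Q ^ m = y at *
    field_simp
    ring

theorem qPoch_inv_pow_eq_zero (Q : RatFunc ℚ) (hQ : Q ≠ 0) {N k : ℕ} (h : N < k) :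
    qPoch (Q ^ N)⁻¹ Q k = 0 := by
  refine Finset.prod_eq_zero (Finset.mem_range.2 h) ?_
  rw [inv_mul_cancel₀ (pow_ne_zero _ hQ), sub_self]

/-- The case of the `q`-Saalschütz sum in which both lower parameters equal the base. -/
theorem q_saalschutz (Q b : RatFunc ℚ) (hQ : Q ≠ 0) (hb : b ≠ 0)
    (hbQ : ∀ j : ℕ, 1 - b * Q ^ j ≠ 0) (hd : ∀ k, qPoch Q Q k ≠ 0) (N : ℕ) :
    ∑ k ∈ range (N + 1),
      qPoch (Q ^ N)⁻¹ Q k * qPoch (b * Q ^ N) Q k * qPoch (Q / b) Q k * Q ^ k / qPoch Q Q k ^ 3 =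
    qPoch b Q N ^ 2 / qPoch Q Q N ^ 2 * (Q / b) ^ N := by
  induction N with
  | zero => simp [qPoch]
  | succ N ih =>
    have h := sum_contiguous Q b (Q ^ N) hQ hb (pow_ne_zero _ hQ) (hbQ N) hd (N + 1)
    rw [qPoch_inv_pow_eq_zero Q hQ N.lt_succ_self, Finset.sum_sub_distrib, ← Finset.mul_sum,
      ← Finset.mul_sum, Finset.sum_range_succ (fun k => qPoch (Q ^ N)⁻¹ Q k * _ * _ * _ / _),
      qPoch_inv_pow_eq_zero Q hQ N.lt_succ_self, ih] at h
    simp only [zero_mul, zero_div, add_zero, mul_zero, ← pow_succ] at h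
    have h3 := hd (N + 1)
    rw [qPoch_succ] at h3
    have h4 := left_ne_zero_of_mul h3
    have h5 : 1 - Q ^ N * Q ≠ 0 := by
      rw [mul_comm]
      exact right_ne_zero_of_mul h3
    have h6 : (1 - Q ^ (N + 1)) ^ 2 * b ≠ 0 :=
      mul_ne_zero (pow_ne_zero _ (by rwa [pow_succ])) hb
    refine mul_left_cancel₀ h6 ((sub_eq_zero.1 h).trans ?_)
    rw [qPoch_succ, qPoch_succ, pow_succ' (Q / b), pow_succ' Q]
    field_simp

/-- The rational functions whose denominator is coprime to `P`. -/
noncomputable def integralAt (P : ℚ[X]) : Subring (RatFunc ℚ) where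
  carrier := {A | ∃ f g : ℚ[X], IsCoprime g P ∧ g ≠ 0 ∧
    A * algebraMap ℚ[X] (RatFunc ℚ) g = algebraMap ℚ[X] (RatFunc ℚ) f}
  mul_mem' := by
    rintro A B ⟨f, g, hg, hg0, h⟩ ⟨f', g', hg', hg0', h'⟩
    refine ⟨f * f', g * g', hg.mul_left hg', mul_ne_zero hg0 hg0', ?_⟩
    rw [map_mul, map_mul, ← h, ← h']
    ring
  one_mem' := ⟨1, 1, isCoprime_one_left, one_ne_zero, by simp⟩
  add_mem' := by
    rintro A B ⟨f, g, hg, hg0, h⟩ ⟨f', g', hg', hg0', h'⟩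
    refine ⟨f * g' + f' * g, g * g', hg.mul_left hg', mul_ne_zero hg0 hg0', ?_⟩
    rw [map_mul, map_add, map_mul, map_mul, ← h, ← h']
    ring
  zero_mem' := ⟨0, 1, isCoprime_one_left, one_ne_zero, by simp⟩
  neg_mem' := by
    rintro A ⟨f, g, hg, hg0, h⟩
    exact ⟨-f, g, hg, hg0, by rw [map_neg, ← h, neg_mul]⟩

theorem algebraMap_mem_integralAt (P f : ℚ[X]) : algebraMap ℚ[X] (RatFunc ℚ) f ∈ integralAt P :=
  ⟨f, 1, isCoprime_one_left, one_ne_zero, by simp⟩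

theorem inv_algebraMap_mem_integralAt {P g : ℚ[X]} (h : IsCoprime g P) (hg : g ≠ 0) :
    (algebraMap ℚ[X] (RatFunc ℚ) g)⁻¹ ∈ integralAt P :=
  ⟨1, g, h, hg, by rw [map_one, inv_mul_cancel₀ (RatFunc.algebraMap_ne_zero hg)]⟩

theorem X_mem_integralAt (P : ℚ[X]) : RatFunc.X ∈ integralAt P :=
  RatFunc.algebraMap_X (K := ℚ) ▸ algebraMap_mem_integralAt P X

theorem congrZero_of_mem {P : ℚ[X]} {A B : RatFunc ℚ} (hB : B ∈ integralAt P)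
    (h : A = algebraMap ℚ[X] (RatFunc ℚ) P * B) : CongrZero A P := by
  obtain ⟨f, g, hg, hg0, hfg⟩ := hB
  refine ⟨B, h, hg.of_isCoprime_of_dvd_left ?_⟩
  rw [RatFunc.denom_dvd hg0]
  exact ⟨f, by rw [← hfg, mul_div_cancel_right₀ _ (RatFunc.algebraMap_ne_zero hg0)]⟩

theorem qPoch_mem {R : Subring (RatFunc ℚ)} {x q : RatFunc ℚ} (hx : x ∈ R) (hq : q ∈ R) (k : ℕ) :
    qPoch x q k ∈ R :=
  R.prod_mem fun j _ => R.sub_mem R.one_mem (R.mul_mem hx (R.pow_mem hq j))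

/-- Perturbing the two numerator parameters `x`, `x` to `x / z`, `x z` changes the product of
their `q`-shifted factorials by a multiple of `(1 - z) ^ 2`. -/
theorem qPoch_sq_sub_mem {R : Subring (RatFunc ℚ)} {x z q : RatFunc ℚ} (hx : x ∈ R) (hz : z ∈ R)
    (hz' : z⁻¹ ∈ R) (hz0 : z ≠ 0) (hq : q ∈ R) (k : ℕ) :
    ∃ C ∈ R, qPoch x q k * qPoch x q k - qPoch (x * z⁻¹) q k * qPoch (x * z) q k =
      (1 - z) ^ 2 * C := by
  induction k with
  | zero => exact ⟨0, R.zero_mem, by simp [qPoch]⟩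
  | succ k ih =>
    obtain ⟨C, hC, h⟩ := ih
    have hqk := R.pow_mem hq k
    have hf : ∀ {y}, y ∈ R → 1 - y * q ^ k ∈ R := fun hy =>
      R.sub_mem R.one_mem (R.mul_mem hy hqk)
    refine ⟨C * ((1 - x * q ^ k) * (1 - x * q ^ k)) +
      qPoch (x * z⁻¹) q k * qPoch (x * z) q k * (x * q ^ k * z⁻¹), ?_, ?_⟩
    · exact R.add_mem (R.mul_mem hC (R.mul_mem (hf hx) (hf hx)))
        (R.mul_mem (R.mul_mem (qPoch_mem (R.mul_mem hx hz') hq k)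
          (qPoch_mem (R.mul_mem hx hz) hq k)) (R.mul_mem (R.mul_mem hx hqk) hz'))
    · simp only [qPoch_succ]
      rw [mul_add, ← mul_assoc _ C, ← h]
      generalize qPoch (x * z⁻¹) q k = U
      generalize qPoch (x * z) q k = V
      generalize qPoch x q k = W
      field_simp
      ring

theorem isCoprime_one_sub_X_pow_cyclotomic {n m : ℕ} (hm : 0 < m) (h : ¬ n ∣ m) :
    IsCoprime (1 - X ^ m : ℚ[X]) (cyclotomic n ℚ) := by
  rw [← neg_sub, IsCoprime.neg_left_iff, ← prod_cyclotomic_eq_X_pow_sub_one hm]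
  refine IsCoprime.prod_left fun d hd => cyclotomic.isCoprime_rat ?_
  rintro rfl
  exact h (Nat.dvd_of_mem_divisors hd)

theorem isCoprime_X_cyclotomic {n : ℕ} (hn : 0 < n) : IsCoprime (X : ℚ[X]) (cyclotomic n ℚ) := by
  refine IsCoprime.of_isCoprime_of_dvd_right ?_ (cyclotomic.dvd_X_pow_sub_one n ℚ)
  exact ⟨X ^ (n - 1), -1, by rw [← pow_succ, Nat.sub_add_cancel hn]; ring⟩

theorem one_sub_X_pow_ne_zero {m : ℕ} (hm : 0 < m) : (1 - X ^ m : ℚ[X]) ≠ 0 := by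
  rw [← neg_sub, neg_ne_zero]
  exact X_pow_sub_C_ne_zero hm 1

theorem ratFunc_one_sub_X_pow (m : ℕ) :
    (1 - RatFunc.X ^ m : RatFunc ℚ) = algebraMap ℚ[X] (RatFunc ℚ) (1 - X ^ m) := by
  simp

theorem ratFunc_one_sub_X_pow_ne_zero {m : ℕ} (hm : 0 < m) :
    (1 - RatFunc.X ^ m : RatFunc ℚ) ≠ 0 := by
  rw [ratFunc_one_sub_X_pow]
  exact RatFunc.algebraMap_ne_zero (one_sub_X_pow_ne_zero hm)

theorem exists_one_sub_X_pow_eq {n m : ℕ} (h : n ∣ m) :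
    ∃ f : ℚ[X], (1 - RatFunc.X ^ m : RatFunc ℚ) =
      algebraMap ℚ[X] (RatFunc ℚ) (cyclotomic n ℚ) * algebraMap ℚ[X] (RatFunc ℚ) f := by
  have h1 : cyclotomic n ℚ ∣ 1 - X ^ m := by
    rw [← neg_sub, dvd_neg]
    obtain ⟨c, rfl⟩ := h
    refine (cyclotomic.dvd_X_pow_sub_one n ℚ).trans ?_
    rw [pow_mul]
    simpa using sub_dvd_pow_sub_pow (X ^ n : ℚ[X]) 1 c
  obtain ⟨f, hf⟩ := h1
  exact ⟨f, by rw [ratFunc_one_sub_X_pow, hf, map_mul]⟩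

theorem congrZero_sum {n N i m l : ℕ} (hn : 0 < n) (hcop : n.Coprime 9) (hN : 1 + 9 * N = m * n)
    (hi : 2 + 9 * i = l * n) (hiN : i < N) (hNn : N < n) :
    CongrZero
      (∑ k ∈ Finset.range n,
        qPoch (RatFunc.X : RatFunc ℚ) (RatFunc.X ^ 9) k * qPoch RatFunc.X (RatFunc.X ^ 9) k
            * qPoch (RatFunc.X ^ 7) (RatFunc.X ^ 9) k * RatFunc.X ^ (9 * k)
          / qPoch (RatFunc.X ^ 9) (RatFunc.X ^ 9) k ^ 3)
      (cyclotomic n ℚ ^ 2) := by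
  set x : RatFunc ℚ := RatFunc.X with hx
  set R := integralAt (cyclotomic n ℚ ^ 2)
  have hx0 : x ≠ 0 := RatFunc.X_ne_zero
  have hxR : x ∈ R := X_mem_integralAt _
  have hxR' : x⁻¹ ∈ R := by
    rw [hx, ← RatFunc.algebraMap_X]
    exact inv_algebraMap_mem_integralAt (isCoprime_X_cyclotomic hn).pow_right X_ne_zero
  have hd0 (k : ℕ) : qPoch (x ^ 9) (x ^ 9) k ≠ 0 := by
    refine Finset.prod_ne_zero_iff.2 fun j _ => ?_
    rw [← pow_mul, ← pow_add]
    exact ratFunc_one_sub_X_pow_ne_zero (by omega)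
  have hdR {k : ℕ} (hk : k < n) : (qPoch (x ^ 9) (x ^ 9) k)⁻¹ ∈ R := by
    rw [qPoch, ← Finset.prod_inv_distrib]
    refine R.prod_mem fun j hj => ?_
    have hj := Finset.mem_range.1 hj
    rw [← pow_mul, ← pow_add, ratFunc_one_sub_X_pow]
    refine inv_algebraMap_mem_integralAt (isCoprime_one_sub_X_pow_cyclotomic (by omega) ?_).pow_right
      (one_sub_X_pow_ne_zero (by omega))
    intro h
    have h9 : n ∣ 9 * (j + 1) := by convert h using 1; ring
    have := Nat.le_of_dvd (by omega) (hcop.dvd_of_dvd_mul_left h9)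
    omega
  have hz : x ^ (m * n) = x * (x ^ 9) ^ N := by rw [← hN, pow_add, pow_mul, pow_one]
  set z := x ^ (m * n)
  have hz0 : z ≠ 0 := pow_ne_zero _ hx0
  have hxz : x * z⁻¹ = ((x ^ 9) ^ N)⁻¹ := by rw [hz]; field_simp
  have hxz' : x * z = x ^ 2 * (x ^ 9) ^ N := by rw [hz]; ring
  have hzR' : z⁻¹ ∈ R := by rw [← inv_pow]; exact R.pow_mem hxR' _
  choose C hC hCeq using
    qPoch_sq_sub_mem hxR (R.pow_mem hxR (m * n)) hzR' hz0 (R.pow_mem hxR 9)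
  obtain ⟨f, hf⟩ := exists_one_sub_X_pow_eq (Dvd.intro_left m rfl : n ∣ m * n)
  obtain ⟨g, hg⟩ := exists_one_sub_X_pow_eq (Dvd.intro_left l rfl : n ∣ l * n)
  have hsum : ∑ k ∈ range n, qPoch (x * z⁻¹) (x ^ 9) k * qPoch (x * z) (x ^ 9) k *
      qPoch (x ^ 7) (x ^ 9) k * x ^ (9 * k) / qPoch (x ^ 9) (x ^ 9) k ^ 3 =
      qPoch (x ^ 2) (x ^ 9) N ^ 2 / qPoch (x ^ 9) (x ^ 9) N ^ 2 * (x ^ 7) ^ N := by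
    have h7 : x ^ 9 / x ^ 2 = x ^ 7 := by field_simp
    have hb (j : ℕ) : 1 - x ^ 2 * (x ^ 9) ^ j ≠ 0 := by
      rw [← pow_mul, ← pow_add]
      exact ratFunc_one_sub_X_pow_ne_zero (by omega)
    have h := q_saalschutz (x ^ 9) (x ^ 2) (pow_ne_zero _ hx0) (pow_ne_zero _ hx0) hb hd0 N
    rw [h7] at h
    rw [← h, hxz, hxz']
    simp only [pow_mul]
    refine (Finset.sum_subset (Finset.range_subset_range.2 hNn) fun k _ hk => ?_).symm
    have hk : N < k := by
      rw [Finset.mem_range] at hk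
      omega
    rw [qPoch_inv_pow_eq_zero _ (pow_ne_zero _ hx0) hk]
    simp
  have hbN : qPoch (x ^ 2) (x ^ 9) N = (1 - x ^ (l * n)) *
      ∏ j ∈ (range N).erase i, (1 - x ^ 2 * (x ^ 9) ^ j) := by
    rw [qPoch, ← Finset.mul_prod_erase _ _ (Finset.mem_range.2 hiN), ← hi, pow_add, pow_mul]
  set E := ∏ j ∈ (range N).erase i, (1 - x ^ 2 * (x ^ 9) ^ j)
  have hE : E ∈ R := R.prod_mem fun j _ => R.sub_mem R.one_mem
    (R.mul_mem (R.pow_mem hxR _) (R.pow_mem (R.pow_mem hxR _) _))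
  have hfR := algebraMap_mem_integralAt (cyclotomic n ℚ ^ 2) f
  have hgR := algebraMap_mem_integralAt (cyclotomic n ℚ ^ 2) g
  have hT {k : ℕ} (hk : k ∈ range n) : C k *
      (qPoch (x ^ 7) (x ^ 9) k * x ^ (9 * k) * (qPoch (x ^ 9) (x ^ 9) k)⁻¹ ^ 3) ∈ R :=
    R.mul_mem (hC k) (R.mul_mem (R.mul_mem (qPoch_mem (R.pow_mem hxR _) (R.pow_mem hxR _) k)
      (R.pow_mem hxR _)) (R.pow_mem (hdR (Finset.mem_range.1 hk)) 3))
  refine congrZero_of_mem (R.add_mem (R.mul_mem (R.pow_mem hfR 2) (R.sum_mem fun k hk => hT hk))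
    (R.mul_mem (R.mul_mem (R.pow_mem (R.mul_mem hgR hE) 2) (R.pow_mem (hdR hNn) 2))
      (R.pow_mem (R.pow_mem hxR 7) N))) ?_
  have hsplit : algebraMap ℚ[X] (RatFunc ℚ) (cyclotomic n ℚ ^ 2) *
      (algebraMap ℚ[X] (RatFunc ℚ) g * E) ^ 2 = qPoch (x ^ 2) (x ^ 9) N ^ 2 := by
    rw [hbN, hg, map_pow]; ring
  have hdiff : algebraMap ℚ[X] (RatFunc ℚ) (cyclotomic n ℚ ^ 2) *
      algebraMap ℚ[X] (RatFunc ℚ) f ^ 2 = (1 - z) ^ 2 := by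
    rw [hf, map_pow]; ring
  rw [mul_add, ← mul_assoc, ← mul_assoc, ← mul_assoc, hsplit, hdiff, inv_pow, ← div_eq_mul_inv,
    ← hsum, Finset.mul_sum, ← Finset.sum_add_distrib]
  refine Finset.sum_congr rfl fun k _ => ?_
  rw [← mul_assoc, ← hCeq]
  ring

theorem stmt12 (n : ℕ) (hn : 0 < n) (hmod : n % 9 = 2 ∨ n % 9 = 8) :
    CongrZero
      (∑ k ∈ Finset.range n,
        qPoch ((RatFunc.X : RatFunc ℚ) ^ (1 : ℤ)) (RatFunc.X ^ 9) k
            * qPoch ((RatFunc.X : RatFunc ℚ) ^ (1 : ℤ)) (RatFunc.X ^ 9) k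
            * qPoch ((RatFunc.X : RatFunc ℚ) ^ (7 : ℤ)) (RatFunc.X ^ 9) k
            * RatFunc.X ^ (9 * k)
          / (qPoch ((RatFunc.X : RatFunc ℚ) ^ 9) (RatFunc.X ^ 9) k) ^ 3)
      ((Polynomial.cyclotomic n ℚ) ^ 2) := by
  have h7 : (RatFunc.X : RatFunc ℚ) ^ (7 : ℤ) = RatFunc.X ^ 7 := zpow_natCast _ 7
  rw [zpow_one, h7]
  have hcop : n.Coprime 9 := by
    refine Nat.Coprime.pow_right 2 (?_ : n.Coprime 3)
    rw [Nat.coprime_comm, Nat.Prime.coprime_iff_not_dvd Nat.prime_three]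
    omega
  rcases hmod with h | h
  · exact congrZero_sum (N := (5 * n - 1) / 9) (i := (n - 2) / 9) (m := 5) (l := 1) hn hcop
      (by omega) (by omega) (by omega) (by omega)
  · exact congrZero_sum (N := (8 * n - 1) / 9) (i := (7 * n - 2) / 9) (m := 8) (l := 7) hn hcop
      (by omega) (by omega) (by omega) (by omega)
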